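/- Restricted Łoś theorem: Let (M,𝒳) ⊨ RCA0, let ℱ be the class of total functions M→M lying in 𝒳, and let 𝒰 be an ultrafilter on 𝒳 all of whose elements are cofinal in M; let (ℱ/𝒰, 𝒳) be the second-order restricted ultrapower. Then: (1) for every Σ1^0 formula φ(x̄) with parameters from (M,𝒳), (ℱ/𝒰,𝒳) ⊨ φ([f̄]) if and only if there exists A ∈ 𝒰 with A ⊆ {i ∈ M : (M,𝒳) ⊨ φ(f̄(i))}; (2) for every formula φ(x̄) which is Δ1^0 over (M,𝒳), (ℱ/𝒰,𝒳) ⊨ φ([f̄]) if and only if {i ∈ M : (M,𝒳) ⊨ φ(f̄(i))} ∈ 𝒰. -/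

import Mathlib

namespace PaperArith

/-! ## Syntax of (two-sorted) first-order arithmetic

Terms and formulas of arithmetic in the language `{0, 1, +, ·, <}`,
with number variables and (monadic second-order) set variables both indexed
by natural numbers.  Bounded quantifiers are taken as primitives, so that the
class `Δ₀` of bounded formulas is a purely syntactic class. -/

/-- Terms of first-order arithmetic in the language `{0, 1, +, ·, <}`. -/
inductive Term : Type
  | var : ℕ → Term
  | zero : Term
  | one : Term
  | add : Term → Term → Term
  | mul : Term → Term → Term

/-- Formulas of (two-sorted) arithmetic.  `mem t i` is the atomic formula
`t ∈ Xᵢ`; `ball x t φ` is `∀ x < t, φ` and `bex x t φ` is `∃ x < t, φ`;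
`sall i φ` and `sex i φ` quantify over the set variable `Xᵢ`.
Purely first-order formulas are those avoiding `mem`, `sall`, `sex`. -/
inductive Fml : Type
  | eq : Term → Term → Fml
  | lt : Term → Term → Fml
  | mem : Term → ℕ → Fml
  | not : Fml → Fml
  | and : Fml → Fml → Fml
  | or : Fml → Fml → Fml
  | imp : Fml → Fml → Fml
  | all : ℕ → Fml → Fml
  | ex : ℕ → Fml → Fml
  | ball : ℕ → Term → Fml → Fml
  | bex : ℕ → Term → Fml → Fml
  | sall : ℕ → Fml → Fml
  | sex : ℕ → Fml → Fml

/-- A structure for the first-order language of arithmetic. -/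
structure Str : Type 1 where
  M : Type
  zero : M
  one : M
  add : M → M → M
  mul : M → M → M
  lt : M → M → Prop

/-- Value of a term under a valuation of the number variables. -/
def tval (S : Str) (v : ℕ → S.M) : Term → S.M
  | .var i => v i
  | .zero => S.zero
  | .one => S.one
  | .add t u => S.add (tval S v t) (tval S v u)
  | .mul t u => S.mul (tval S v t) (tval S v u)

/-- Update a valuation at one variable. -/
def upd {α : Type} (v : ℕ → α) (x : ℕ) (a : α) : ℕ → α :=
  fun i => if i = x then a else v i

/-- Tarskian satisfaction over the structure `S`, with second-order universe
`X` (set quantifiers range over `X`); `v` is the valuation of number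
variables, `w` the valuation of set variables. -/
def Sat (S : Str) (X : Set (Set S.M)) : (ℕ → S.M) → (ℕ → Set S.M) → Fml → Prop
  | v, _, .eq t u => tval S v t = tval S v u
  | v, _, .lt t u => S.lt (tval S v t) (tval S v u)
  | v, w, .mem t i => tval S v t ∈ w i
  | v, w, .not φ => ¬ Sat S X v w φ
  | v, w, .and φ ψ => Sat S X v w φ ∧ Sat S X v w ψ
  | v, w, .or φ ψ => Sat S X v w φ ∨ Sat S X v w ψ
  | v, w, .imp φ ψ => Sat S X v w φ → Sat S X v w ψ
  | v, w, .all x φ => ∀ m : S.M, Sat S X (upd v x m) w φ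
  | v, w, .ex x φ => ∃ m : S.M, Sat S X (upd v x m) w φ
  | v, w, .ball x t φ => ∀ m : S.M, S.lt m (tval S v t) → Sat S X (upd v x m) w φ
  | v, w, .bex x t φ => ∃ m : S.M, S.lt m (tval S v t) ∧ Sat S X (upd v x m) w φ
  | v, w, .sall i φ => ∀ A : Set S.M, A ∈ X → Sat S X v (upd w i A) φ
  | v, w, .sex i φ => ∃ A : Set S.M, A ∈ X ∧ Sat S X v (upd w i A) φ

/-- First-order satisfaction (for purely first-order formulas the second-order
data is irrelevant). -/
def Sat0 (S : Str) (v : ℕ → S.M) (φ : Fml) : Prop :=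
  Sat S ∅ v (fun _ => ∅) φ

/-! ## The arithmetic hierarchy -/

/-- `Δ₀` formulas: purely first-order, only bounded quantifiers. -/
inductive Delta0 : Fml → Prop
  | eq (t u : Term) : Delta0 (.eq t u)
  | lt (t u : Term) : Delta0 (.lt t u)
  | not {φ : Fml} : Delta0 φ → Delta0 (.not φ)
  | and {φ ψ : Fml} : Delta0 φ → Delta0 ψ → Delta0 (.and φ ψ)
  | or {φ ψ : Fml} : Delta0 φ → Delta0 ψ → Delta0 (.or φ ψ)
  | imp {φ ψ : Fml} : Delta0 φ → Delta0 ψ → Delta0 (.imp φ ψ)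
  | ball (x : ℕ) (t : Term) {φ : Fml} : Delta0 φ → Delta0 (.ball x t φ)
  | bex (x : ℕ) (t : Term) {φ : Fml} : Delta0 φ → Delta0 (.bex x t φ)

mutual
  /-- `Σₙ` formulas of the first-order arithmetic hierarchy. -/
  inductive IsSigma : ℕ → Fml → Prop
    | delta0 {n : ℕ} {φ : Fml} : Delta0 φ → IsSigma n φ
    | ofPi {n : ℕ} {φ : Fml} : IsPi n φ → IsSigma (n + 1) φ
    | ex (x : ℕ) {n : ℕ} {φ : Fml} : IsSigma (n + 1) φ → IsSigma (n + 1) (.ex x φ)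
  /-- `Πₙ` formulas of the first-order arithmetic hierarchy. -/
  inductive IsPi : ℕ → Fml → Prop
    | delta0 {n : ℕ} {φ : Fml} : Delta0 φ → IsPi n φ
    | ofSigma {n : ℕ} {φ : Fml} : IsSigma n φ → IsPi (n + 1) φ
    | all (x : ℕ) {n : ℕ} {φ : Fml} : IsPi (n + 1) φ → IsPi (n + 1) (.all x φ)
end

/-- `Σ₀(Σₙ)`: the closure of `Σₙ` under Boolean operations and bounded
quantification. -/
inductive Sigma0Sigma (n : ℕ) : Fml → Prop
  | ofSigma {φ : Fml} : IsSigma n φ → Sigma0Sigma n φ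
  | not {φ : Fml} : Sigma0Sigma n φ → Sigma0Sigma n (.not φ)
  | and {φ ψ : Fml} : Sigma0Sigma n φ → Sigma0Sigma n ψ → Sigma0Sigma n (.and φ ψ)
  | or {φ ψ : Fml} : Sigma0Sigma n φ → Sigma0Sigma n ψ → Sigma0Sigma n (.or φ ψ)
  | imp {φ ψ : Fml} : Sigma0Sigma n φ → Sigma0Sigma n ψ → Sigma0Sigma n (.imp φ ψ)
  | ball (x : ℕ) (t : Term) {φ : Fml} : Sigma0Sigma n φ → Sigma0Sigma n (.ball x t φ)
  | bex (x : ℕ) (t : Term) {φ : Fml} : Sigma0Sigma n φ → Sigma0Sigma n (.bex x t φ)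

/-- The class `Σₙ ∧ Πₙ` of conjunctions of a `Σₙ` and a `Πₙ` formula. -/
def SigmaAndPi (n : ℕ) (φ : Fml) : Prop :=
  ∃ ψ χ : Fml, IsSigma n ψ ∧ IsPi n χ ∧ φ = Fml.and ψ χ

/-- The class `Σₙ ∨ Πₙ` of disjunctions of a `Σₙ` and a `Πₙ` formula. -/
def SigmaOrPi (n : ℕ) (φ : Fml) : Prop :=
  ∃ ψ χ : Fml, IsSigma n ψ ∧ IsPi n χ ∧ φ = Fml.or ψ χ

/-- `Δ₀⁰` formulas of second-order arithmetic: only bounded first-order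
quantifiers; free set variables (set parameters) are allowed. -/
inductive Delta0SO : Fml → Prop
  | eq (t u : Term) : Delta0SO (.eq t u)
  | lt (t u : Term) : Delta0SO (.lt t u)
  | mem (t : Term) (i : ℕ) : Delta0SO (.mem t i)
  | not {φ : Fml} : Delta0SO φ → Delta0SO (.not φ)
  | and {φ ψ : Fml} : Delta0SO φ → Delta0SO ψ → Delta0SO (.and φ ψ)
  | or {φ ψ : Fml} : Delta0SO φ → Delta0SO ψ → Delta0SO (.or φ ψ)
  | imp {φ ψ : Fml} : Delta0SO φ → Delta0SO ψ → Delta0SO (.imp φ ψ)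
  | ball (x : ℕ) (t : Term) {φ : Fml} : Delta0SO φ → Delta0SO (.ball x t φ)
  | bex (x : ℕ) (t : Term) {φ : Fml} : Delta0SO φ → Delta0SO (.bex x t φ)

mutual
  /-- `Σₙ⁰` formulas of the second-order arithmetic hierarchy
  (set parameters allowed, no set quantifiers). -/
  inductive SigmaSO : ℕ → Fml → Prop
    | delta0 {n : ℕ} {φ : Fml} : Delta0SO φ → SigmaSO n φ
    | ofPi {n : ℕ} {φ : Fml} : PiSO n φ → SigmaSO (n + 1) φ
    | ex (x : ℕ) {n : ℕ} {φ : Fml} : SigmaSO (n + 1) φ → SigmaSO (n + 1) (.ex x φ)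
  /-- `Πₙ⁰` formulas of the second-order arithmetic hierarchy. -/
  inductive PiSO : ℕ → Fml → Prop
    | delta0 {n : ℕ} {φ : Fml} : Delta0SO φ → PiSO n φ
    | ofSigma {n : ℕ} {φ : Fml} : SigmaSO n φ → PiSO (n + 1) φ
    | all (x : ℕ) {n : ℕ} {φ : Fml} : PiSO (n + 1) φ → PiSO (n + 1) (.all x φ)
end

/-! ## First-order theories -/

/-- `PA⁻`: the theory of non-negative parts of discretely ordered rings. -/
structure PAminus (S : Str) : Prop where
  add_assoc : ∀ a b c, S.add (S.add a b) c = S.add a (S.add b c)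
  add_comm : ∀ a b, S.add a b = S.add b a
  mul_assoc : ∀ a b c, S.mul (S.mul a b) c = S.mul a (S.mul b c)
  mul_comm : ∀ a b, S.mul a b = S.mul b a
  distrib : ∀ a b c, S.mul a (S.add b c) = S.add (S.mul a b) (S.mul a c)
  add_zero : ∀ a, S.add a S.zero = a
  mul_zero : ∀ a, S.mul a S.zero = S.zero
  mul_one : ∀ a, S.mul a S.one = a
  lt_irrefl : ∀ a, ¬ S.lt a a
  lt_trans : ∀ a b c, S.lt a b → S.lt b c → S.lt a c
  lt_total : ∀ a b, S.lt a b ∨ a = b ∨ S.lt b a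
  add_lt_add : ∀ a b c, S.lt a b → S.lt (S.add a c) (S.add b c)
  mul_lt_mul : ∀ a b c, S.lt a b → S.lt S.zero c → S.lt (S.mul a c) (S.mul b c)
  zero_lt_one : S.lt S.zero S.one
  zero_le : ∀ a, a = S.zero ∨ S.lt S.zero a
  discrete : ∀ a b, S.lt a b → S.add a S.one = b ∨ S.lt (S.add a S.one) b
  pred : ∀ a, S.lt S.zero a → ∃ b, S.add b S.one = a
  sub : ∀ a b, S.lt a b → ∃ c, S.add a c = b

/-- The induction scheme for the class `Γ` of formulas
(parameters are allowed via the ambient valuation `v`). -/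
def IndFor (S : Str) (Γ : Fml → Prop) : Prop :=
  ∀ φ : Fml, Γ φ → ∀ (v : ℕ → S.M) (x : ℕ),
    Sat0 S (upd v x S.zero) φ →
    (∀ m, Sat0 S (upd v x m) φ → Sat0 S (upd v x (S.add m S.one)) φ) →
    ∀ m, Sat0 S (upd v x m) φ

/-- The collection scheme for the class `Γ`:
`(∀ x < a ∃ y φ) → (∃ b ∀ x < a ∃ y < b φ)`. -/
def CollFor (S : Str) (Γ : Fml → Prop) : Prop :=
  ∀ φ : Fml, Γ φ → ∀ (v : ℕ → S.M) (x y : ℕ), x ≠ y → ∀ a : S.M,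
    (∀ m, S.lt m a → ∃ k, Sat0 S (upd (upd v x m) y k) φ) →
    ∃ b, ∀ m, S.lt m a → ∃ k, S.lt k b ∧ Sat0 S (upd (upd v x m) y k) φ

/-- `IΔ₀` (over `PA⁻`). -/
def IDelta0 (S : Str) : Prop := PAminus S ∧ IndFor S Delta0

/-- `IΣₙ` (over `PA⁻`; note `Δ₀ ⊆ Σₙ`, so this includes `IΔ₀`). -/
def ISigma (S : Str) (n : ℕ) : Prop := PAminus S ∧ IndFor S (IsSigma n)

/-- `BΣₙ`: the `Σₙ`-collection scheme, including `IΔ₀` (over `PA⁻`). -/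
def BSigma (S : Str) (n : ℕ) : Prop := IDelta0 S ∧ CollFor S (IsSigma n)

/-- The weak regularity principle `WRφ` for all `φ` in the class `Γ`:
the universal closure of `(∀ x ∃ y < a φ(x,y)) → (∃ y < a ∀ b ∃ x > b φ(x,y))`.
Here `x, y` are the two displayed variables and all other free variables of
`φ` are parameters, interpreted by the ambient valuation `v`. -/
def WRFor (S : Str) (Γ : Fml → Prop) : Prop :=
  ∀ φ : Fml, Γ φ → ∀ (v : ℕ → S.M) (x y : ℕ), x ≠ y → ∀ a : S.M,
    (∀ m, ∃ k, S.lt k a ∧ Sat0 S (upd (upd v x m) y k) φ) →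
    ∃ k, S.lt k a ∧ ∀ b, ∃ m, S.lt b m ∧ Sat0 S (upd (upd v x m) y k) φ

/-! ## Second-order theories -/

/-- Second-order induction scheme for the class `Γ`, with set parameters
from the second-order universe `X`. -/
def IndForSO (S : Str) (X : Set (Set S.M)) (Γ : Fml → Prop) : Prop :=
  ∀ φ : Fml, Γ φ → ∀ (v : ℕ → S.M) (w : ℕ → Set S.M), (∀ i, w i ∈ X) → ∀ x : ℕ,
    Sat S X (upd v x S.zero) w φ →
    (∀ m, Sat S X (upd v x m) w φ → Sat S X (upd v x (S.add m S.one)) w φ) →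
    ∀ m, Sat S X (upd v x m) w φ

/-- Second-order collection scheme for the class `Γ`. -/
def CollForSO (S : Str) (X : Set (Set S.M)) (Γ : Fml → Prop) : Prop :=
  ∀ φ : Fml, Γ φ → ∀ (v : ℕ → S.M) (w : ℕ → Set S.M), (∀ i, w i ∈ X) →
    ∀ (x y : ℕ), x ≠ y → ∀ a : S.M,
    (∀ m, S.lt m a → ∃ k, Sat S X (upd (upd v x m) y k) w φ) →
    ∃ b, ∀ m, S.lt m a → ∃ k, S.lt k b ∧ Sat S X (upd (upd v x m) y k) w φ

/-- `Δ₁⁰`-comprehension. -/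
def Delta1CA (S : Str) (X : Set (Set S.M)) : Prop :=
  ∀ φ ψ : Fml, SigmaSO 1 φ → PiSO 1 ψ →
    ∀ (v : ℕ → S.M) (w : ℕ → Set S.M), (∀ i, w i ∈ X) → ∀ x : ℕ,
    (∀ m, Sat S X (upd v x m) w φ ↔ Sat S X (upd v x m) w ψ) →
    ∃ A ∈ X, ∀ m, m ∈ A ↔ Sat S X (upd v x m) w φ

/-- `Σₙ`-comprehension for first-order formulas with parameters from `M`. -/
def SigmaCA (S : Str) (X : Set (Set S.M)) (n : ℕ) : Prop :=
  ∀ φ : Fml, IsSigma n φ → ∀ (v : ℕ → S.M) (x : ℕ),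
    ∃ A ∈ X, ∀ m, m ∈ A ↔ Sat0 S (upd v x m) φ

/-- `RCA₀`. -/
def RCA0 (S : Str) (X : Set (Set S.M)) : Prop :=
  PAminus S ∧ IndForSO S X (SigmaSO 1) ∧ Delta1CA S X

/-- `Σ₁⁰`-separation; over `RCA₀` this is equivalent to weak Kőnig's lemma. -/
def Sigma1Sep (S : Str) (X : Set (Set S.M)) : Prop :=
  ∀ φ ψ : Fml, SigmaSO 1 φ → SigmaSO 1 ψ →
    ∀ (v : ℕ → S.M) (w : ℕ → Set S.M), (∀ i, w i ∈ X) → ∀ x : ℕ,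
    (∀ m, ¬ (Sat S X (upd v x m) w φ ∧ Sat S X (upd v x m) w ψ)) →
    ∃ A ∈ X, ∀ m, (Sat S X (upd v x m) w φ → m ∈ A) ∧ (m ∈ A → ¬ Sat S X (upd v x m) w ψ)

/-- `WKL₀`, rendered as `RCA₀` plus `Σ₁⁰`-separation (which is equivalent,
over `RCA₀`, to weak Kőnig's lemma). -/
def WKL0 (S : Str) (X : Set (Set S.M)) : Prop := RCA0 S X ∧ Sigma1Sep S X

/-- `BΣₙ⁰`: the second-order `Σₙ⁰`-collection scheme (including `IΔ₀⁰`,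
over `PA⁻`). -/
def BSigmaSO (S : Str) (X : Set (Set S.M)) (n : ℕ) : Prop :=
  PAminus S ∧ IndForSO S X Delta0SO ∧ CollForSO S X (SigmaSO n)

/-- `IΣₙ⁰`: the second-order `Σₙ⁰`-induction scheme, over `RCA₀`. -/
def ISigmaSO (S : Str) (X : Set (Set S.M)) (n : ℕ) : Prop :=
  RCA0 S X ∧ IndForSO S X (SigmaSO n)

/-! ## Exponentiation and binary digits -/

/-- Satisfaction of a three-variable formula `E(x₀, x₁, x₂)` at `(a, b, c)`. -/
def ExpAt (S : Str) (E : Fml) (a b c : S.M) : Prop :=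
  Sat0 S (fun i => if i = 0 then a else if i = 1 then b else c) E

/-- `E(x₀,x₁,x₂)` is a `Δ₀` definition of the (total) exponentiation function
`x₀ ^ x₁ = x₂`.  The existence of such an `E` expresses `exp`
(the totality of exponentiation). -/
structure IsExpDef (S : Str) (E : Fml) : Prop where
  delta0 : Delta0 E
  base : ∀ a, ExpAt S E a S.zero S.one
  total : ∀ a b, ∃ c, ExpAt S E a b c
  unique : ∀ a b c c', ExpAt S E a b c → ExpAt S E a b c' → c = c'
  step : ∀ a b c, ExpAt S E a b c → ExpAt S E a (S.add b S.one) (S.mul c a)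

/-- `exp`: the totality of exponentiation (via a `Δ₀` definition of its
graph). -/
def SatExp (S : Str) : Prop := ∃ E : Fml, IsExpDef S E

/-! ## Embeddings, end extensions and elementarity -/

/-- An embedding of arithmetic structures. -/
structure Emb (S K : Str) where
  j : S.M → K.M
  inj : Function.Injective j
  zero : j S.zero = K.zero
  one : j S.one = K.one
  add : ∀ a b, j (S.add a b) = K.add (j a) (j b)
  mul : ∀ a b, j (S.mul a b) = K.mul (j a) (j b)
  lt_iff : ∀ a b, S.lt a b ↔ K.lt (j a) (j b)

/-- The extension along `e` is an end extension: every element of `K` not in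
the image of `M` exceeds every element of `M`. -/
def IsEndExt {S K : Str} (e : Emb S K) : Prop :=
  ∀ b : K.M, b ∉ Set.range e.j → ∀ a : S.M, K.lt (e.j a) b

/-- The extension along `e` is proper. -/
def IsProper {S K : Str} (e : Emb S K) : Prop := ¬ Function.Surjective e.j

/-- The extension along `e` is `Σₙ`-elementary: all `Σₙ` formulas with
parameters from `M` are absolute between `M` and `K`. -/
def SigmaElem {S K : Str} (e : Emb S K) (n : ℕ) : Prop :=
  ∀ φ : Fml, IsSigma n φ → ∀ v : ℕ → S.M,
    (Sat0 S v φ ↔ Sat0 K (fun i => e.j (v i)) φ)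

/-- `K ⊨ M‑IΣₙ` (for an extension `e : M → K`): induction up to any `a ∈ M`
for `Σₙ` formulas with parameters from `K`. -/
def MISigma {S K : Str} (e : Emb S K) (n : ℕ) : Prop :=
  ∀ φ : Fml, IsSigma n φ → ∀ (v : ℕ → K.M) (x : ℕ) (a : S.M),
    Sat0 K (upd v x K.zero) φ →
    (∀ m, K.lt m (e.j a) → (Sat0 K (upd v x m) φ → Sat0 K (upd v x (K.add m K.one)) φ)) →
    ∀ m, K.lt m (e.j a) → Sat0 K (upd v x m) φ

/-- The `x`-th binary digit of `c ∈ K` is `1`, computed via a `Δ₀` definition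
`E` of exponentiation on the ground model `S` (here `x` lies under the image
of `S`): there are `x', p ∈ M` with `j x' = x`, `p = 2 ^ x'`, and `u, v ∈ K`
with `c = u·(2p) + p + v` and `v < p`. -/
def BitVia {S K : Str} (e : Emb S K) (E : Fml) (x c : K.M) : Prop :=
  ∃ x' p : S.M, e.j x' = x ∧ ExpAt S E (S.add S.one S.one) x' p ∧
    ∃ u v : K.M, K.lt v (e.j p) ∧
      c = K.add (K.add (K.mul u (K.add (e.j p) (e.j p))) (e.j p)) v

/-! ## The second-order restricted ultrapower -/

/-- `A` is cofinal (unbounded) in `S`. -/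
def Cofinal (S : Str) (A : Set S.M) : Prop := ∀ b : S.M, ∃ x ∈ A, S.lt b x

/-- The pairing term `⟨x, y⟩ = (x + y)·(x + y) + x`. -/
def pairS (S : Str) (x y : S.M) : S.M := S.add (S.mul (S.add x y) (S.add x y)) x

/-- The graph of `f : M → M`, coded as a subset of `M` via pairing. -/
def graphOf (S : Str) (f : S.M → S.M) : Set S.M := {m | ∃ x, m = pairS S x (f x)}

/-- `f` is a total function `M → M` lying in the second-order universe `X`
(its coded graph belongs to `X`).  The collection of such `f` is the class
`ℱ` of the restricted ultrapower. -/
def FuncIn (S : Str) (X : Set (Set S.M)) (f : S.M → S.M) : Prop := graphOf S f ∈ X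

/-- `U` is an ultrafilter on the Boolean algebra `X`, all of whose elements
are cofinal in `M`. -/
structure UltraOn (S : Str) (X U : Set (Set S.M)) : Prop where
  subset : U ⊆ X
  univ_mem : Set.univ ∈ U
  empty_not_mem : ∅ ∉ U
  inter_mem : ∀ A ∈ U, ∀ B ∈ U, A ∩ B ∈ U
  superset_mem : ∀ A ∈ U, ∀ B ∈ X, A ⊆ B → B ∈ U
  ultra : ∀ A ∈ X, A ∈ U ∨ Aᶜ ∈ U
  cofinal : ∀ A ∈ U, Cofinal S A

/-- A realization of the second-order restricted ultrapower `ℱ/𝒰` of `S`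
with respect to the second-order universe `X` and the ultrafilter `U`:
a structure `K` whose elements are exactly the classes `cls f hf = [f]` of
total functions `f ∈ ℱ`, where `[f] = [g]` iff `f = g` on a set in `U`, with
pointwise arithmetic operations, order decided by `U`, and the inherited
second-order membership relation `memK` serving as the second-order expansion. -/
structure RUP (S : Str) (X U : Set (Set S.M)) : Type 1 where
  K : Str
  cls : (f : S.M → S.M) → FuncIn S X f → K.M
  memK : K.M → Set S.M → Prop
  const_in : ∀ a : S.M, FuncIn S X (fun _ => a)
  surj : ∀ b : K.M, ∃ (f : S.M → S.M) (hf : FuncIn S X f), cls f hf = b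
  eq_iff : ∀ (f : S.M → S.M) (hf : FuncIn S X f) (g : S.M → S.M) (hg : FuncIn S X g),
      (cls f hf = cls g hg) ↔ {i : S.M | f i = g i} ∈ U
  lt_iff : ∀ (f : S.M → S.M) (hf : FuncIn S X f) (g : S.M → S.M) (hg : FuncIn S X g),
      K.lt (cls f hf) (cls g hg) ↔ {i : S.M | S.lt (f i) (g i)} ∈ U
  zero_eq : K.zero = cls (fun _ => S.zero) (const_in S.zero)
  one_eq : K.one = cls (fun _ => S.one) (const_in S.one)
  add_eq : ∀ (f : S.M → S.M) (hf : FuncIn S X f) (g : S.M → S.M) (hg : FuncIn S X g)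
      (h : S.M → S.M) (hh : FuncIn S X h), (∀ i, h i = S.add (f i) (g i)) →
      K.add (cls f hf) (cls g hg) = cls h hh
  mul_eq : ∀ (f : S.M → S.M) (hf : FuncIn S X f) (g : S.M → S.M) (hg : FuncIn S X g)
      (h : S.M → S.M) (hh : FuncIn S X h), (∀ i, h i = S.mul (f i) (g i)) →
      K.mul (cls f hf) (cls g hg) = cls h hh
  mem_iff : ∀ (f : S.M → S.M) (hf : FuncIn S X f) (A : Set S.M), A ∈ X →
      (memK (cls f hf) A ↔ {i : S.M | f i ∈ A} ∈ U)

/-- The canonical embedding `M → ℱ/𝒰` via constant functions. -/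
def RUP.emb {S : Str} {X U : Set (Set S.M)} (R : RUP S X U) (a : S.M) : R.K.M :=
  R.cls (fun _ => a) (R.const_in a)

/-- The subset of `ℱ/𝒰` induced by `A ⊆ M`. -/
def RUP.setImg {S : Str} {X U : Set (Set S.M)} (R : RUP S X U) (A : Set S.M) :
    Set R.K.M := {b | R.memK b A}

/-- The second-order part of the expanded ultrapower `(ℱ/𝒰, 𝒳)`:
the (injected) copy of `X`. -/
def RUP.X2 {S : Str} {X U : Set (Set S.M)} (R : RUP S X U) : Set (Set R.K.M) :=
  (fun A => R.setImg A) '' X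

end PaperArith

namespace PaperArith

/-! ### Order and pairing in `PA⁻` -/

section Order

variable {S : Str}

/-- The commutative semiring underlying a model of `PA⁻`. -/
abbrev PAminus.commSemiring (h : PAminus S) : CommSemiring S.M :=
  letI : Add S.M := ⟨S.add⟩
  letI : Mul S.M := ⟨S.mul⟩
  letI : Zero S.M := ⟨S.zero⟩
  letI : One S.M := ⟨S.one⟩
  { add_assoc := h.add_assoc
    zero_add := fun a => (h.add_comm _ _).trans (h.add_zero a)
    add_zero := h.add_zero
    add_comm := h.add_comm
    nsmul := nsmulRec
    left_distrib := h.distrib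
    right_distrib := fun a b c => by
      change S.mul (S.add a b) c = S.add (S.mul a c) (S.mul b c)
      rw [h.mul_comm, h.distrib, h.mul_comm c a, h.mul_comm c b]
    zero_mul := fun a => (h.mul_comm _ _).trans (h.mul_zero a)
    mul_zero := h.mul_zero
    mul_assoc := h.mul_assoc
    one_mul := fun a => (h.mul_comm _ _).trans (h.mul_one a)
    mul_one := h.mul_one
    mul_comm := h.mul_comm }

/-- The linear order underlying a model of `PA⁻`. -/
noncomputable abbrev PAminus.linearOrder (h : PAminus S) : LinearOrder S.M :=
  { le := fun a b => a = b ∨ S.lt a b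
    lt := S.lt
    le_refl := fun _ => Or.inl rfl
    le_trans := by
      rintro a b c (rfl | hab) (rfl | hbc)
      · exact Or.inl rfl
      · exact Or.inr hbc
      · exact Or.inr hab
      · exact Or.inr (h.lt_trans _ _ _ hab hbc)
    lt_iff_le_not_ge := by
      intro a b
      refine ⟨fun hab => ⟨Or.inr hab, ?_⟩, ?_⟩
      · rintro (rfl | hba)
        · exact h.lt_irrefl _ hab
        · exact h.lt_irrefl _ (h.lt_trans _ _ _ hab hba)
      · rintro ⟨rfl | hab, hn⟩
        · exact absurd (Or.inl rfl) hn
        · exact hab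
    le_antisymm := by
      rintro a b (rfl | hab) (hba | hba)
      · rfl
      · rfl
      · exact hba.symm
      · exact absurd (h.lt_trans _ _ _ hab hba) (h.lt_irrefl _)
    le_total := by
      intro a b
      rcases h.lt_total a b with hab | rfl | hba
      · exact Or.inl (Or.inr hab)
      · exact Or.inl (Or.inl rfl)
      · exact Or.inr (Or.inr hba)
    toDecidableLE := Classical.decRel _ }

theorem PAminus.lt_succ_iff (h : PAminus S) {a b : S.M} :
    S.lt a (S.add b S.one) ↔ S.lt a b ∨ a = b := by
  have hb : S.lt b (S.add b S.one) := by
    have := h.add_lt_add _ _ b h.zero_lt_one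
    rwa [h.add_comm, h.add_zero, h.add_comm] at this
  constructor
  · intro hab
    rcases h.lt_total a b with hlt | heq | hgt
    · exact Or.inl hlt
    · exact Or.inr heq
    · rcases h.discrete _ _ hgt with heq | hlt
      · exact absurd (heq ▸ hab) (h.lt_irrefl _)
      · exact absurd (h.lt_trans _ _ _ hab hlt) (h.lt_irrefl _)
  · rintro (hab | rfl)
    · exact h.lt_trans _ _ _ hab hb
    · exact hb

theorem PAminus.not_lt_zero (h : PAminus S) (a : S.M) : ¬ S.lt a S.zero := by
  intro ha
  rcases h.zero_le a with rfl | h0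
  · exact h.lt_irrefl _ ha
  · exact h.lt_irrefl _ (h.lt_trans _ _ _ ha h0)

theorem PAminus.zero_lt_succ (h : PAminus S) (a : S.M) : S.lt S.zero (S.add a S.one) := by
  rw [h.lt_succ_iff]
  exact (h.zero_le a).symm.imp_right Eq.symm

theorem pairing_injective {R : Type*} [CommSemiring R] [LinearOrder R] [IsStrictOrderedRing R]
    (h0 : ∀ a : R, 0 ≤ a) (hd : ∀ a b : R, a < b → a + 1 ≤ b) {x y x' y' : R}
    (h : (x + y) * (x + y) + x = (x' + y') * (x' + y') + x') : x = x' ∧ y = y' := by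
  have key : ∀ a b c d : R, a + b < c + d →
      (a + b) * (a + b) + a < (c + d) * (c + d) + c := by
    intro a b c d hlt
    have h1 := hd _ _ hlt
    calc (a + b) * (a + b) + a < (a + b) * (a + b) + a + (a + b + b + 1) := by
          have : 0 < a + b + b + 1 := lt_of_lt_of_le zero_lt_one (le_add_of_nonneg_left (h0 _))
          exact lt_add_of_pos_right _ this
      _ = (a + b + 1) * (a + b + 1) := by ring
      _ ≤ (c + d) * (c + d) := mul_le_mul h1 h1 (h0 _) (h0 _)
      _ ≤ (c + d) * (c + d) + c := le_add_of_nonneg_right (h0 _)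
  have hs : x + y = x' + y' := by
    rcases lt_trichotomy (x + y) (x' + y') with hlt | heq | hgt
    · exact absurd h (key _ _ _ _ hlt).ne
    · exact heq
    · exact absurd h.symm (key _ _ _ _ hgt).ne
  rw [hs] at h
  have hx := add_left_cancel h
  rw [hx] at hs
  exact ⟨hx, add_left_cancel hs⟩

theorem le_pairing_right {R : Type*} [CommSemiring R] [LinearOrder R] [IsStrictOrderedRing R]
    (h0 : ∀ a : R, 0 ≤ a) (hd : ∀ a b : R, a < b → a + 1 ≤ b) (x y : R) :
    y ≤ (x + y) * (x + y) + x := by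
  have hy : y ≤ x + y := le_add_of_nonneg_left (h0 _)
  rcases (h0 (x + y)).eq_or_lt with hs | hs
  · rw [← hs] at hy
    exact hy.trans (h0 _)
  · have h1 : 1 ≤ x + y := by simpa using hd _ _ hs
    exact (hy.trans (le_mul_of_one_le_left (h0 _) h1)).trans (le_add_of_nonneg_right (h0 _))

theorem PAminus.pair_facts (h : PAminus S) :
    (∀ x y, S.lt x (S.add (pairS S x y) S.one)) ∧
    (∀ x y, S.lt y (S.add (pairS S x y) S.one)) ∧
    (∀ x y x' y', pairS S x y = pairS S x' y' → x = x' ∧ y = y') := by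
  let := h.commSemiring
  let := h.linearOrder
  have hsucc : ∀ a b : S.M, a ≤ b → S.lt a (S.add b S.one) := fun a b hab =>
    h.lt_succ_iff.2 hab.symm
  have h0 : ∀ a : S.M, 0 ≤ a := fun a => (h.zero_le a).imp_left Eq.symm
  have hd : ∀ a b : S.M, a < b → a + 1 ≤ b := h.discrete
  have hadd : ∀ a b c : S.M, a < b → a + c < b + c := h.add_lt_add
  have hmul : ∀ a b c : S.M, a < b → 0 < c → a * c < b * c := h.mul_lt_mul
  have hadd' : ∀ a b c : S.M, a ≤ b → a + c ≤ b + c := by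
    intro a b c hab
    rcases hab.eq_or_lt with rfl | hab
    · exact le_rfl
    · exact (hadd _ _ c hab).le
  have : IsStrictOrderedRing S.M :=
    { add_le_add_left := fun a b hab c => hadd' a b c hab
      le_of_add_le_add_left := fun a b c habc => by
        by_contra hcb
        have := hadd c b a (not_le.1 hcb)
        rw [_root_.add_comm c, _root_.add_comm b] at this
        exact absurd habc (not_le.2 this)
      zero_le_one := h0 1
      exists_pair_ne := ⟨0, 1, fun h01 => h.lt_irrefl S.zero (by
        have := h.zero_lt_one
        rwa [← show S.zero = S.one from h01] at this)⟩
      mul_lt_mul_of_pos_left := fun a ha b c hbc => by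
        have := hmul b c a hbc ha
        rwa [_root_.mul_comm b, _root_.mul_comm c] at this
      mul_lt_mul_of_pos_right := fun a ha b c hbc => hmul b c a hbc ha }
  refine ⟨fun x y => hsucc _ _ ?_, fun x y => hsucc _ _ ?_, fun x y x' y' hp => ?_⟩
  · exact le_add_of_nonneg_left (h0 ((x + y) * (x + y)))
  · exact le_pairing_right h0 hd x y
  · exact pairing_injective h0 hd hp

end Order

/-! ### Relations defined by bounded formulas -/

section Definability

variable {S : Str} {X : Set (Set S.M)} {w : ℕ → Set S.M}

/-- `P` is definable by a `Δ₀⁰` formula with set parameters `w`. -/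
def BddDef (S : Str) (X : Set (Set S.M)) (w : ℕ → Set S.M) (P : (ℕ → S.M) → Prop) : Prop :=
  ∃ φ, Delta0SO φ ∧ ∀ v, Sat S X v w φ ↔ P v

namespace BddDef

variable {P Q : (ℕ → S.M) → Prop}

theorem congr (h : BddDef S X w P) (hPQ : ∀ v, P v ↔ Q v) : BddDef S X w Q :=
  (funext fun v => propext (hPQ v) : P = Q) ▸ h

theorem eq (t u : Term) : BddDef S X w fun v => tval S v t = tval S v u :=
  ⟨_, .eq t u, fun _ => Iff.rfl⟩

theorem lt (t u : Term) : BddDef S X w fun v => S.lt (tval S v t) (tval S v u) :=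
  ⟨_, .lt t u, fun _ => Iff.rfl⟩

theorem mem (t : Term) (i : ℕ) : BddDef S X w fun v => tval S v t ∈ w i :=
  ⟨_, .mem t i, fun _ => Iff.rfl⟩

theorem not (h : BddDef S X w P) : BddDef S X w fun v => ¬ P v := by
  obtain ⟨φ, hφ, hs⟩ := h
  exact ⟨_, .not hφ, fun v => not_congr (hs v)⟩

theorem and (h : BddDef S X w P) (h' : BddDef S X w Q) : BddDef S X w fun v => P v ∧ Q v := by
  obtain ⟨φ, hφ, hs⟩ := h
  obtain ⟨ψ, hψ, hs'⟩ := h'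
  exact ⟨_, .and hφ hψ, fun v => and_congr (hs v) (hs' v)⟩

theorem or (h : BddDef S X w P) (h' : BddDef S X w Q) : BddDef S X w fun v => P v ∨ Q v := by
  obtain ⟨φ, hφ, hs⟩ := h
  obtain ⟨ψ, hψ, hs'⟩ := h'
  exact ⟨_, .or hφ hψ, fun v => or_congr (hs v) (hs' v)⟩

theorem imp (h : BddDef S X w P) (h' : BddDef S X w Q) : BddDef S X w fun v => P v → Q v := by
  obtain ⟨φ, hφ, hs⟩ := h
  obtain ⟨ψ, hψ, hs'⟩ := h'
  exact ⟨_, .imp hφ hψ, fun v => imp_congr (hs v) (hs' v)⟩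

theorem bex (x : ℕ) (t : Term) (h : BddDef S X w P) :
    BddDef S X w fun v => ∃ m, S.lt m (tval S v t) ∧ P (upd v x m) := by
  obtain ⟨φ, hφ, hs⟩ := h
  exact ⟨_, .bex x t hφ, fun v => exists_congr fun m => and_congr Iff.rfl (hs _)⟩

theorem ball (x : ℕ) (t : Term) (h : BddDef S X w P) :
    BddDef S X w fun v => ∀ m, S.lt m (tval S v t) → P (upd v x m) := by
  obtain ⟨φ, hφ, hs⟩ := h
  exact ⟨_, .ball x t hφ, fun v => forall_congr' fun m => imp_congr Iff.rfl (hs _)⟩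

end BddDef

theorem RCA0.delta1_mem (hR : RCA0 S X) (hw : ∀ k, w k ∈ X) {p q : S.M → S.M → Prop}
    (hp : BddDef S X w fun v => p (v 1) (v 2)) (hq : BddDef S X w fun v => q (v 1) (v 2))
    (h : ∀ m, (∃ k, p m k) ↔ ∀ k, q m k) : {m | ∃ k, p m k} ∈ X := by
  obtain ⟨φ, hφ, hsφ⟩ := hp
  obtain ⟨ψ, hψ, hsψ⟩ := hq
  have e1 : ∀ m, Sat S X (upd (fun _ => S.zero) 1 m) w (.ex 2 φ) ↔ ∃ k, p m k := fun m =>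
    exists_congr fun k => hsφ _
  have e2 : ∀ m, Sat S X (upd (fun _ => S.zero) 1 m) w (.all 2 ψ) ↔ ∀ k, q m k := fun m =>
    forall_congr' fun k => hsψ _
  obtain ⟨A, hA, hm⟩ := hR.2.2 (.ex 2 φ) (.all 2 ψ) (.ex _ (.delta0 hφ)) (.all _ (.delta0 hψ))
    (fun _ => S.zero) w hw 1 fun m => (e1 m).trans ((h m).trans (e2 m).symm)
  rwa [show A = {m | ∃ k, p m k} from Set.ext fun m => (hm m).trans (e1 m)] at hA

theorem RCA0.bdd_mem (hR : RCA0 S X) (hw : ∀ k, w k ∈ X) {p : S.M → Prop}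
    (hp : BddDef S X w fun v => p (v 1)) : {m | p m} ∈ X := by
  have : Nonempty S.M := ⟨S.zero⟩
  have := hR.delta1_mem hw (p := fun m _ => p m) (q := fun m _ => p m) hp hp
    fun m => by simp
  simpa using this

/-- The least number principle for members of `X`. -/
theorem RCA0.exists_least (hR : RCA0 S X) {A : Set S.M} (hA : A ∈ X) (hne : A.Nonempty) :
    ∃ m ∈ A, ∀ z, S.lt z m → z ∉ A := by
  by_contra! hcon
  have hd : Delta0SO (.ball 2 (.var 1) (.not (.mem (.var 2) 0))) := .ball _ _ (.not (.mem _ _))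
  have key := hR.2.1 _ (.delta0 hd) (fun _ => S.zero) (fun _ => A) (fun _ => hA) 1
    (fun m hm => absurd hm (hR.1.not_lt_zero m)) ?_
  · obtain ⟨a, ha⟩ := hne
    exact key (S.add a S.one) a (hR.1.lt_succ_iff.2 (Or.inr rfl)) ha
  · intro m hm z hz hzA
    obtain ⟨y, hy, hyA⟩ := hcon z hzA
    rcases hR.1.lt_succ_iff.1 hz with hlt | rfl
    · exact hm z hlt hzA
    · exact hm y hy hyA

/-- The set parameters `A, B, B, …`. -/
def twoSets (A B : Set S.M) : ℕ → Set S.M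
  | 0 => A
  | _ + 1 => B

theorem twoSets_mem {A B : Set S.M} (hA : A ∈ X) (hB : B ∈ X) : ∀ k, twoSets A B k ∈ X
  | 0 => hA
  | _ + 1 => hB

theorem RCA0.compl_mem (hR : RCA0 S X) {A : Set S.M} (hA : A ∈ X) : Aᶜ ∈ X :=
  hR.bdd_mem (w := fun _ => A) (fun _ => hA) (BddDef.mem (.var 1) 0).not

theorem RCA0.inter_mem (hR : RCA0 S X) {A B : Set S.M} (hA : A ∈ X) (hB : B ∈ X) : A ∩ B ∈ X :=
  hR.bdd_mem (twoSets_mem hA hB) ((BddDef.mem (.var 1) 0).and (BddDef.mem (.var 1) 1))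

/-- The term denoting the pair of the values of `t` and `u`. -/
def pairTm (t u : Term) : Term := .add (.mul (.add t u) (.add t u)) t

/-- The successor term. -/
def succTm (t : Term) : Term := .add t .one

open Classical in
/-- First projection of the pairing function, with value `0` off its range. -/
noncomputable def fstS (S : Str) (m : S.M) : S.M :=
  if h : ∃ x y, m = pairS S x y then h.choose else S.zero

open Classical in
/-- Second projection of the pairing function, with value `0` off its range. -/
noncomputable def sndS (S : Str) (m : S.M) : S.M :=
  if h : ∃ x y, m = pairS S x y then h.choose_spec.choose else S.zero

theorem PAminus.proj_pair (h : PAminus S) (x y : S.M) :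
    fstS S (pairS S x y) = x ∧ sndS S (pairS S x y) = y := by
  have he : ∃ x' y', pairS S x y = pairS S x' y' := ⟨x, y, rfl⟩
  simp only [fstS, sndS, dif_pos he]
  have := h.pair_facts.2.2 _ _ _ _ he.choose_spec.choose_spec
  exact ⟨this.1.symm, this.2.symm⟩

theorem PAminus.fst_pair (h : PAminus S) (x y : S.M) : fstS S (pairS S x y) = x :=
  (h.proj_pair x y).1

theorem PAminus.snd_pair (h : PAminus S) (x y : S.M) : sndS S (pairS S x y) = y :=
  (h.proj_pair x y).2

theorem PAminus.proj_lt (h : PAminus S) (m : S.M) :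
    S.lt (fstS S m) (S.add m S.one) ∧ S.lt (sndS S m) (S.add m S.one) := by
  by_cases he : ∃ x y, m = pairS S x y
  · obtain ⟨x, y, rfl⟩ := he
    rw [h.fst_pair, h.snd_pair]
    exact ⟨h.pair_facts.1 x y, h.pair_facts.2.1 x y⟩
  · simp only [fstS, sndS, dif_neg he]
    exact ⟨h.zero_lt_succ m, h.zero_lt_succ m⟩

theorem PAminus.proj_iff (h : PAminus S) (m a b : S.M) :
    (a = fstS S m ∧ b = sndS S m) ↔
      (m = pairS S a b ∨
        ((∀ x, S.lt x (S.add m S.one) → ∀ y, S.lt y (S.add m S.one) → ¬ m = pairS S x y) ∧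
          a = S.zero ∧ b = S.zero)) := by
  by_cases he : ∃ x y, m = pairS S x y
  · obtain ⟨x, y, rfl⟩ := he
    rw [h.fst_pair, h.snd_pair]
    constructor
    · rintro ⟨rfl, rfl⟩
      exact Or.inl rfl
    · rintro (hp | ⟨hn, -⟩)
      · exact (h.pair_facts.2.2 _ _ _ _ hp).imp Eq.symm Eq.symm
      · exact absurd rfl (hn x (h.pair_facts.1 x y) y (h.pair_facts.2.1 x y))
  · have hn : ∀ x y, ¬ m = pairS S x y := fun x y hxy => he ⟨x, y, hxy⟩
    simp [fstS, sndS, hn]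

theorem PAminus.bddDef_proj (h : PAminus S) {p : S.M → S.M → S.M → S.M → Prop}
    (hp : BddDef S X w fun v => p (v 1) (v 2) (v 3) (v 4)) :
    BddDef S X w fun v => p (v 1) (v 2) (fstS S (v 1)) (sndS S (v 1)) := by
  have hU : BddDef S X w fun v => v 1 = pairS S (v 3) (v 4) ∨
        ((∀ x, S.lt x (S.add (v 1) S.one) → ∀ y, S.lt y (S.add (v 1) S.one) →
          ¬ v 1 = pairS S x y) ∧ v 3 = S.zero ∧ v 4 = S.zero) :=
    (BddDef.eq (.var 1) (pairTm (.var 3) (.var 4))).or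
      (((((BddDef.eq (.var 1) (pairTm (.var 5) (.var 6))).not.ball 6 (succTm (.var 1))).ball 5
        (succTm (.var 1)))).and ((BddDef.eq (.var 3) .zero).and (BddDef.eq (.var 4) .zero)))
  have hB : BddDef S X w fun v => ∃ a, S.lt a (S.add (v 1) S.one) ∧
      ∃ b, S.lt b (S.add (v 1) S.one) ∧ ((v 1 = pairS S a b ∨
        ((∀ x, S.lt x (S.add (v 1) S.one) → ∀ y, S.lt y (S.add (v 1) S.one) →
          ¬ v 1 = pairS S x y) ∧ a = S.zero ∧ b = S.zero)) ∧ p (v 1) (v 2) a b) :=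
    ((hU.and hp).bex 4 (succTm (.var 1))).bex 3 (succTm (.var 1))
  refine hB.congr fun v => ?_
  simp only [← h.proj_iff]
  constructor
  · rintro ⟨a, -, b, -, ⟨rfl, rfl⟩, hab⟩
    exact hab
  · intro hab
    exact ⟨_, (h.proj_lt _).1, _, (h.proj_lt _).2, ⟨rfl, rfl⟩, hab⟩

/-! ### Closure properties of the class of functions in `X` -/

theorem PAminus.pair_mem_graphOf (h : PAminus S) (f : S.M → S.M) (x y : S.M) :
    pairS S x y ∈ graphOf S f ↔ y = f x := by
  constructor
  · rintro ⟨a, ha⟩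
    obtain ⟨rfl, rfl⟩ := h.pair_facts.2.2 _ _ _ _ ha
    rfl
  · rintro rfl
    exact ⟨x, rfl⟩

theorem RCA0.funcIn_of_mem (hR : RCA0 S X) {B : Set S.M} (hB : B ∈ X) {f : S.M → S.M}
    (h : ∀ x y, pairS S x y ∈ B ↔ y = f x) : FuncIn S X f := by
  have hd : BddDef S X (fun _ => B) fun v => ∃ a, S.lt a (S.add (v 1) S.one) ∧
      ∃ b, S.lt b (S.add (v 1) S.one) ∧ v 1 = pairS S a b ∧ pairS S a b ∈ B :=
    (((BddDef.eq (.var 1) (pairTm (.var 3) (.var 4))).and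
      (BddDef.mem (pairTm (.var 3) (.var 4)) 0)).bex 4 (succTm (.var 1))).bex 3 (succTm (.var 1))
  have := hR.bdd_mem (w := fun _ => B) (fun _ => hB) (p := fun m => ∃ a, S.lt a (S.add m S.one) ∧
    ∃ b, S.lt b (S.add m S.one) ∧ m = pairS S a b ∧ pairS S a b ∈ B) hd
  unfold FuncIn
  convert this using 1
  ext m
  constructor
  · rintro ⟨x, rfl⟩
    exact ⟨_, hR.1.pair_facts.1 _ _, _, hR.1.pair_facts.2.1 _ _, rfl, (h _ _).2 rfl⟩
  · rintro ⟨a, -, b, -, rfl, hab⟩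
    exact ⟨a, by rw [(h _ _).1 hab]⟩

theorem RCA0.rel_mem (hR : RCA0 S X) (hw : ∀ k, w k ∈ X) {r : S.M → S.M → Prop}
    (hr : BddDef S X w fun v => r (v 3) (v 4)) : {m | r (fstS S m) (sndS S m)} ∈ X :=
  hR.bdd_mem hw (hR.1.bddDef_proj (p := fun _ _ a b => r a b) hr)

theorem RCA0.funcIn_of_bddDef (hR : RCA0 S X) (hw : ∀ k, w k ∈ X) {f : S.M → S.M}
    (hf : BddDef S X w fun v => v 4 = f (v 3)) : FuncIn S X f :=
  hR.funcIn_of_mem (hR.rel_mem hw (r := fun a b => b = f a) hf) fun x y => by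
    simp [hR.1.fst_pair, hR.1.snd_pair]

theorem RCA0.preimage_mem (hR : RCA0 S X) {f : S.M → S.M} (hf : FuncIn S X f)
    {A : Set S.M} (hA : A ∈ X) : {i | f i ∈ A} ∈ X := by
  have hg : BddDef S X (twoSets (graphOf S f) A) fun v => v 2 = f (v 1) :=
    (BddDef.mem (pairTm (.var 1) (.var 2)) 0).congr fun v => hR.1.pair_mem_graphOf f _ _
  have hm : BddDef S X (twoSets (graphOf S f) A) fun v => v 2 ∈ A := BddDef.mem (.var 2) 1
  have := hR.delta1_mem (twoSets_mem hf hA) (p := fun i k => k = f i ∧ k ∈ A)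
    (q := fun i k => k = f i → k ∈ A) (hg.and hm) (hg.imp hm) fun m => by simp
  simpa using this

theorem RCA0.funcIn_comp (hR : RCA0 S X) {f g : S.M → S.M} (hf : FuncIn S X f)
    (hg : FuncIn S X g) : FuncIn S X fun i => f (g i) := by
  have hd : BddDef S X (twoSets (graphOf S f) (graphOf S g)) fun v => v 2 = g (v 3) :=
    (BddDef.mem (pairTm (.var 3) (.var 2)) 1).congr fun v => hR.1.pair_mem_graphOf g _ _
  have hd' : BddDef S X (twoSets (graphOf S f) (graphOf S g)) fun v => v 4 = f (v 2) :=
    (BddDef.mem (pairTm (.var 2) (.var 4)) 0).congr fun v => hR.1.pair_mem_graphOf f _ _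
  have h1 := hR.1.bddDef_proj (p := fun _ k a b => k = g a ∧ b = f k) (hd.and hd')
  have h2 := hR.1.bddDef_proj (p := fun _ k a b => k = g a → b = f k) (hd.imp hd')
  have := hR.delta1_mem (twoSets_mem hf hg)
    (p := fun m k => k = g (fstS S m) ∧ sndS S m = f k)
    (q := fun m k => k = g (fstS S m) → sndS S m = f k) h1 h2 fun m => by simp
  refine hR.funcIn_of_mem this fun x y => ?_
  simp [hR.1.fst_pair, hR.1.snd_pair]

theorem RCA0.funcIn_pair (hR : RCA0 S X) {f g : S.M → S.M} (hf : FuncIn S X f)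
    (hg : FuncIn S X g) : FuncIn S X fun i => pairS S (f i) (g i) := by
  have hd : BddDef S X (twoSets (graphOf S f) (graphOf S g)) fun v => v 5 = f (v 3) :=
    (BddDef.mem (pairTm (.var 3) (.var 5)) 0).congr fun v => hR.1.pair_mem_graphOf f _ _
  have hd' : BddDef S X (twoSets (graphOf S f) (graphOf S g)) fun v => v 6 = g (v 3) :=
    (BddDef.mem (pairTm (.var 3) (.var 6)) 1).congr fun v => hR.1.pair_mem_graphOf g _ _
  have hB : BddDef S X (twoSets (graphOf S f) (graphOf S g)) fun v =>
      ∃ a, S.lt a (S.add (v 4) S.one) ∧ ∃ b, S.lt b (S.add (v 4) S.one) ∧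
        v 4 = pairS S a b ∧ a = f (v 3) ∧ b = g (v 3) :=
    (((BddDef.eq (.var 4) (pairTm (.var 5) (.var 6))).and (hd.and hd')).bex 6
      (succTm (.var 4))).bex 5 (succTm (.var 4))
  refine hR.funcIn_of_bddDef (twoSets_mem hf hg) (hB.congr fun v => ⟨?_, fun h => ?_⟩)
  · rintro ⟨a, -, b, -, h, rfl, rfl⟩
    exact h
  · refine ⟨_, ?_, _, ?_, h, rfl, rfl⟩
    · rw [h]
      exact hR.1.pair_facts.1 _ _
    · rw [h]
      exact hR.1.pair_facts.2.1 _ _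

theorem RCA0.funcIn_proj (hR : RCA0 S X) (hw : ∀ k, w k ∈ X) {G : S.M → S.M → S.M}
    (hG : BddDef S X w fun v => v 2 = G (v 3) (v 4)) :
    FuncIn S X fun m => G (fstS S m) (sndS S m) := by
  have hB : BddDef S X w fun v =>
      ∃ a, S.lt a (S.add (v 3) S.one) ∧ ∃ b, S.lt b (S.add (v 4) S.one) ∧
        (a = v 3 ∧ b = v 4 ∧ b = G (fstS S a) (sndS S a)) :=
    (((BddDef.eq (.var 1) (.var 3)).and ((BddDef.eq (.var 2) (.var 4)).and
      (hR.1.bddDef_proj (p := fun _ k a b => k = G a b) hG))).bex 2 (succTm (.var 4))).bex 1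
        (succTm (.var 3))
  refine hR.funcIn_of_bddDef hw (hB.congr fun v => ⟨?_, fun h => ?_⟩)
  · rintro ⟨a, -, b, -, rfl, rfl, h⟩
    exact h
  · exact ⟨_, hR.1.lt_succ_iff.2 (Or.inr rfl), _, hR.1.lt_succ_iff.2 (Or.inr rfl), rfl, rfl, h⟩

theorem RCA0.funcIn_op (hR : RCA0 S X) (hw : ∀ k, w k ∈ X) {G : S.M → S.M → S.M}
    (hG : BddDef S X w fun v => v 2 = G (v 3) (v 4)) {f g : S.M → S.M} (hf : FuncIn S X f)
    (hg : FuncIn S X g) : FuncIn S X fun i => G (f i) (g i) := by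
  simpa [hR.1.fst_pair, hR.1.snd_pair] using
    hR.funcIn_comp (hR.funcIn_proj hw hG) (hR.funcIn_pair hf hg)

theorem RCA0.setOf_rel_mem (hR : RCA0 S X) (hw : ∀ k, w k ∈ X) {r : S.M → S.M → Prop}
    (hr : BddDef S X w fun v => r (v 3) (v 4)) {f g : S.M → S.M} (hf : FuncIn S X f)
    (hg : FuncIn S X g) : {i | r (f i) (g i)} ∈ X := by
  simpa [hR.1.fst_pair, hR.1.snd_pair] using
    hR.preimage_mem (hR.funcIn_pair hf hg) (hR.rel_mem hw hr)

end Definability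

/-! ### The sets defined by bounded and `Σ₁⁰` formulas along functions in `X` -/

section TruthSets

variable {S : Str} {X : Set (Set S.M)} {w : ℕ → Set S.M}

theorem RCA0.exists_funcIn_least (hR : RCA0 S X) {A B : Set S.M} (hA : A ∈ X) (hB : B ∈ X)
    (hAB : ∀ i ∈ A, ∃ y, pairS S i y ∈ B) :
    ∃ g, FuncIn S X g ∧ ∀ i ∈ A, pairS S i (g i) ∈ B := by
  have hleast : ∀ i, ∃ y, (i ∈ A ∧ pairS S i y ∈ B ∧ ∀ z, S.lt z y → ¬ pairS S i z ∈ B) ∨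
      (¬ i ∈ A ∧ y = S.zero) := by
    intro i
    by_cases hi : i ∈ A
    · have hBi : {y | pairS S i y ∈ B} ∈ X :=
        (hR.preimage_mem (hR.funcIn_pair
          (hR.funcIn_of_bddDef (w := fun _ => {m | m = i}) (f := fun _ => i) (fun _ => ?_)
            (BddDef.mem (.var 4) 0))
          (hR.funcIn_of_bddDef (w := fun _ => A) (f := id) (fun _ => hA)
            (BddDef.eq (.var 4) (.var 3)))) hB)
      · obtain ⟨y, hy, hz⟩ := hR.exists_least hBi (hAB i hi)
        exact ⟨y, Or.inl ⟨hi, hy, hz⟩⟩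
      · obtain ⟨C, hC, hm⟩ := hR.2.2 _ _ (.delta0 (.eq (.var 1) (.var 0)))
          (.delta0 (.eq (.var 1) (.var 0))) (fun _ => i) (fun _ => A) (fun _ => hA) 1
          fun _ => Iff.rfl
        rwa [show C = {m | m = i} from Set.ext hm] at hC
    · exact ⟨S.zero, Or.inr ⟨hi, rfl⟩⟩
  choose g hg using hleast
  have hd : BddDef S X (twoSets A B) fun v =>
      (v 3 ∈ A ∧ pairS S (v 3) (v 4) ∈ B ∧ ∀ z, S.lt z (v 4) → ¬ pairS S (v 3) z ∈ B) ∨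
      (¬ v 3 ∈ A ∧ v 4 = S.zero) :=
    ((BddDef.mem (.var 3) 0).and ((BddDef.mem (pairTm (.var 3) (.var 4)) 1).and
      ((BddDef.mem (pairTm (.var 3) (.var 5)) 1).not.ball 5 (.var 4)))).or
    ((BddDef.mem (.var 3) 0).not.and (BddDef.eq (.var 4) .zero))
  refine ⟨g, hR.funcIn_of_bddDef (twoSets_mem hA hB) (hd.congr fun v => ⟨fun h => ?_, fun h => ?_⟩),
    fun i hi => ?_⟩
  · rcases h with ⟨h1, h2, h3⟩ | ⟨h1, h2⟩ <;> rcases hg (v 3) with ⟨k1, k2, k3⟩ | ⟨k1, k2⟩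
    · rcases hR.1.lt_total (v 4) (g (v 3)) with h | h | h
      · exact absurd h2 (k3 _ h)
      · exact h
      · exact absurd k2 (h3 _ h)
    · exact absurd h1 k1
    · exact absurd k1 h1
    · exact h2.trans k2.symm
  · rw [h]
    exact hg (v 3)
  · rcases hg i with h | h
    · exact h.2.1
    · exact absurd hi h.1

theorem RCA0.funcIn_tval (hR : RCA0 S X) (hw : ∀ k, w k ∈ X) {F : ℕ → S.M → S.M}
    (hF : ∀ k, FuncIn S X (F k)) (t : Term) : FuncIn S X fun i => tval S (fun k => F k i) t := by
  induction t with
  | var k => exact hF k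
  | zero => exact hR.funcIn_of_bddDef hw (f := fun _ => S.zero) (BddDef.eq (.var 4) .zero)
  | one => exact hR.funcIn_of_bddDef hw (f := fun _ => S.one) (BddDef.eq (.var 4) .one)
  | add t u ht hu =>
    exact hR.funcIn_op hw (G := S.add) (BddDef.eq (.var 2) (.add (.var 3) (.var 4))) ht hu
  | mul t u ht hu =>
    exact hR.funcIn_op hw (G := S.mul) (BddDef.eq (.var 2) (.mul (.var 3) (.var 4))) ht hu

theorem RCA0.funcIn_id (hR : RCA0 S X) (hw : ∀ k, w k ∈ X) : FuncIn S X fun i => i :=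
  hR.funcIn_of_bddDef hw (BddDef.eq (.var 4) (.var 3))

theorem RCA0.funcIn_fst (hR : RCA0 S X) (hw : ∀ k, w k ∈ X) : FuncIn S X (fstS S) :=
  hR.funcIn_proj hw (G := fun a _ => a) (BddDef.eq (.var 2) (.var 3))

theorem RCA0.funcIn_snd (hR : RCA0 S X) (hw : ∀ k, w k ∈ X) : FuncIn S X (sndS S) :=
  hR.funcIn_proj hw (G := fun _ b => b) (BddDef.eq (.var 2) (.var 4))

/-- The assignment of functions `F` composed with the first projection, with the second projection
assigned to the variable `x`. -/
noncomputable def extFun (F : ℕ → S.M → S.M) (x : ℕ) : ℕ → S.M → S.M :=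
  upd (fun k m => F k (fstS S m)) x (sndS S)

theorem extFun_pair (h : PAminus S) (F : ℕ → S.M → S.M) (x : ℕ) (i y : S.M) :
    (fun k => extFun F x k (pairS S i y)) = upd (fun k => F k i) x y := by
  funext k
  unfold extFun upd
  split_ifs
  · exact h.snd_pair i y
  · exact congrArg (F k) (h.fst_pair i y)

theorem funcIn_upd {F : ℕ → S.M → S.M} (hF : ∀ k, FuncIn S X (F k)) {g : S.M → S.M}
    (hg : FuncIn S X g) (x k : ℕ) : FuncIn S X (upd F x g k) := by
  unfold upd
  split_ifs
  · exact hg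
  · exact hF k

theorem upd_apply {α β : Type} (F : ℕ → α → β) (x : ℕ) (g : α → β) (i : α) :
    (fun k => upd F x g k i) = upd (fun k => F k i) x (g i) := by
  funext k
  unfold upd
  split_ifs <;> rfl

theorem RCA0.funcIn_extFun (hR : RCA0 S X) (hw : ∀ k, w k ∈ X) {F : ℕ → S.M → S.M}
    (hF : ∀ k, FuncIn S X (F k)) (x k : ℕ) : FuncIn S X (extFun F x k) :=
  funcIn_upd (fun k => hR.funcIn_comp (hF k) (hR.funcIn_fst hw)) (hR.funcIn_snd hw) x k

theorem RCA0.truthSet_mem (hR : RCA0 S X) (hw : ∀ k, w k ∈ X) {φ : Fml} (hφ : Delta0SO φ) :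
    ∀ {F : ℕ → S.M → S.M}, (∀ k, FuncIn S X (F k)) →
      {i | Sat S X (fun k => F k i) w φ} ∈ X := by
  induction hφ with
  | eq t u =>
    intro F hF
    exact hR.setOf_rel_mem hw (r := fun a b => a = b) (BddDef.eq (.var 3) (.var 4))
      (hR.funcIn_tval hw hF t) (hR.funcIn_tval hw hF u)
  | lt t u =>
    intro F hF
    exact hR.setOf_rel_mem hw (r := S.lt) (BddDef.lt (.var 3) (.var 4))
      (hR.funcIn_tval hw hF t) (hR.funcIn_tval hw hF u)
  | mem t i =>
    intro F hF
    exact hR.preimage_mem (hR.funcIn_tval hw hF t) (hw i)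
  | not _ ih =>
    intro F hF
    exact hR.compl_mem (ih hF)
  | and _ _ ih ih' =>
    intro F hF
    exact hR.inter_mem (ih hF) (ih' hF)
  | or _ _ ih ih' =>
    intro F hF
    exact hR.bdd_mem (twoSets_mem (ih hF) (ih' hF))
      ((BddDef.mem (.var 1) 0).or (BddDef.mem (.var 1) 1))
  | imp _ _ ih ih' =>
    intro F hF
    exact hR.bdd_mem (twoSets_mem (ih hF) (ih' hF))
      ((BddDef.mem (.var 1) 0).imp (BddDef.mem (.var 1) 1))
  | @ball x t φ _ ih =>
    intro F hF
    have hB := ih (hR.funcIn_extFun hw hF x)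
    have := hR.setOf_rel_mem (w := fun _ => _) (fun _ => hB)
      (r := fun a b => ∀ y, S.lt y b → pairS S a y ∈ _)
      ((BddDef.mem (pairTm (.var 3) (.var 5)) 0).ball 5 (.var 4)) (hR.funcIn_id hw)
      (hR.funcIn_tval hw hF t)
    simpa only [Set.mem_ofPred_eq, extFun_pair hR.1, Sat] using this
  | @bex x t φ _ ih =>
    intro F hF
    have hB := ih (hR.funcIn_extFun hw hF x)
    have := hR.setOf_rel_mem (w := fun _ => _) (fun _ => hB)
      (r := fun a b => ∃ y, S.lt y b ∧ pairS S a y ∈ _)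
      ((BddDef.mem (pairTm (.var 3) (.var 5)) 0).bex 5 (.var 4)) (hR.funcIn_id hw)
      (hR.funcIn_tval hw hF t)
    simpa only [Set.mem_ofPred_eq, extFun_pair hR.1, Sat] using this

/-- Blocks of existential quantifiers followed by a bounded formula. -/
inductive ExBdd : Fml → Prop
  | delta0 {φ : Fml} : Delta0SO φ → ExBdd φ
  | ex (x : ℕ) {φ : Fml} : ExBdd φ → ExBdd (.ex x φ)

/-- Blocks of universal quantifiers followed by a bounded formula. -/
inductive AllBdd : Fml → Prop
  | delta0 {φ : Fml} : Delta0SO φ → AllBdd φ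
  | all (x : ℕ) {φ : Fml} : AllBdd φ → AllBdd (.all x φ)

theorem SigmaSO.exBdd : ∀ {φ : Fml}, SigmaSO 1 φ → ExBdd φ
  | _, .delta0 h => .delta0 h
  | _, .ofPi (.delta0 h) => .delta0 h
  | _, .ex x h => .ex x h.exBdd

theorem PiSO.allBdd : ∀ {φ : Fml}, PiSO 1 φ → AllBdd φ
  | _, .delta0 h => .delta0 h
  | _, .ofSigma (.delta0 h) => .delta0 h
  | _, .all x h => .all x h.allBdd

theorem RCA0.mem_reindex (hR : RCA0 S X) (hw : ∀ k, w k ∈ X) {B : Set S.M} (hB : B ∈ X) :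
    ∃ C ∈ X, ∀ i q, pairS S i q ∈ C ↔ pairS S (pairS S i (fstS S q)) (sndS S q) ∈ B := by
  have h1 := hR.funcIn_fst hw
  have h2 := hR.funcIn_snd hw
  refine ⟨_, hR.preimage_mem (hR.funcIn_pair (hR.funcIn_pair h1 (hR.funcIn_comp h1 h2))
    (hR.funcIn_comp h2 h2)) hB, fun i q => ?_⟩
  simp only [Set.mem_ofPred_eq, hR.1.fst_pair, hR.1.snd_pair]

theorem RCA0.exBdd_projection (hR : RCA0 S X) (hw : ∀ k, w k ∈ X) {φ : Fml} (hφ : ExBdd φ) :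
    ∀ {F : ℕ → S.M → S.M}, (∀ k, FuncIn S X (F k)) →
      ∃ B ∈ X, ∀ i, Sat S X (fun k => F k i) w φ ↔ ∃ z, pairS S i z ∈ B := by
  induction hφ with
  | delta0 h =>
    intro F hF
    refine ⟨_, hR.preimage_mem (hR.funcIn_fst hw) (hR.truthSet_mem hw h hF), fun i => ?_⟩
    have : Nonempty S.M := ⟨i⟩
    simp [hR.1.fst_pair]
  | ex x _ ih =>
    intro F hF
    obtain ⟨B, hB, hs⟩ := ih (hR.funcIn_extFun hw hF x)
    obtain ⟨C, hC, hCB⟩ := hR.mem_reindex hw hB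
    refine ⟨C, hC, fun i => ?_⟩
    simp only [Sat, ← extFun_pair hR.1, hs, hCB]
    constructor
    · rintro ⟨y, z, h⟩
      exact ⟨pairS S y z, by rwa [hR.1.fst_pair, hR.1.snd_pair]⟩
    · rintro ⟨q, h⟩
      exact ⟨_, _, h⟩

theorem RCA0.allBdd_projection (hR : RCA0 S X) (hw : ∀ k, w k ∈ X) {φ : Fml} (hφ : AllBdd φ) :
    ∀ {F : ℕ → S.M → S.M}, (∀ k, FuncIn S X (F k)) →
      ∃ B ∈ X, ∀ i, Sat S X (fun k => F k i) w φ ↔ ∀ z, pairS S i z ∈ B := by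
  induction hφ with
  | delta0 h =>
    intro F hF
    refine ⟨_, hR.preimage_mem (hR.funcIn_fst hw) (hR.truthSet_mem hw h hF), fun i => ?_⟩
    have : Nonempty S.M := ⟨i⟩
    simp [hR.1.fst_pair]
  | all x _ ih =>
    intro F hF
    obtain ⟨B, hB, hs⟩ := ih (hR.funcIn_extFun hw hF x)
    obtain ⟨C, hC, hCB⟩ := hR.mem_reindex hw hB
    refine ⟨C, hC, fun i => ?_⟩
    simp only [Sat, ← extFun_pair hR.1, hs, hCB]
    constructor
    · exact fun h q => h _ _
    · intro h y z
      have := h (pairS S y z)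
      rwa [hR.1.fst_pair, hR.1.snd_pair] at this

theorem RCA0.delta1_truthSet_mem (hR : RCA0 S X) (hw : ∀ k, w k ∈ X) {φ ψ : Fml}
    (hφ : SigmaSO 1 φ) (hψ : PiSO 1 ψ) (h : ∀ u, Sat S X u w φ ↔ Sat S X u w ψ)
    {F : ℕ → S.M → S.M} (hF : ∀ k, FuncIn S X (F k)) :
    {i | Sat S X (fun k => F k i) w φ} ∈ X := by
  obtain ⟨B, hB, hBs⟩ := hR.exBdd_projection hw hφ.exBdd hF
  obtain ⟨C, hC, hCs⟩ := hR.allBdd_projection hw hψ.allBdd hF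
  simp only [hBs]
  exact hR.delta1_mem (twoSets_mem hB hC) (p := fun m k => pairS S m k ∈ B)
    (BddDef.mem (pairTm (.var 1) (.var 2)) 0) (BddDef.mem (pairTm (.var 1) (.var 2)) 1)
    fun m => by rw [← hBs, h, hCs]

end TruthSets

/-! ### Łoś's theorem -/

section Los

variable {S : Str} {X U : Set (Set S.M)} {w : ℕ → Set S.M}

theorem UltraOn.not_iff (hU : UltraOn S X U) {p : S.M → Prop} (hp : {i | p i} ∈ X) :
    ¬ {i | p i} ∈ U ↔ {i | ¬ p i} ∈ U := by
  constructor
  · exact (hU.ultra _ hp).resolve_left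
  · intro h h'
    have := hU.inter_mem _ h' _ h
    rw [show {i | p i} ∩ {i | ¬ p i} = ∅ from Set.inter_compl_self _] at this
    exact hU.empty_not_mem this

theorem UltraOn.and_iff (hU : UltraOn S X U) {p q : S.M → Prop} (hp : {i | p i} ∈ X)
    (hq : {i | q i} ∈ X) : {i | p i ∧ q i} ∈ U ↔ {i | p i} ∈ U ∧ {i | q i} ∈ U :=
  ⟨fun h => ⟨hU.superset_mem _ h _ hp fun _ => And.left,
    hU.superset_mem _ h _ hq fun _ => And.right⟩, fun h => hU.inter_mem _ h.1 _ h.2⟩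

theorem RUP.upd_cls (R : RUP S X U) {F : ℕ → S.M → S.M} (hF : ∀ k, FuncIn S X (F k))
    {g : S.M → S.M} (hg : FuncIn S X g) (x : ℕ) :
    upd (fun k => R.cls (F k) (hF k)) x (R.cls g hg) =
      fun k => R.cls (upd F x g k) (funcIn_upd hF hg x k) := by
  have hcongr : ∀ (f f' : S.M → S.M) (hf : FuncIn S X f) (hf' : FuncIn S X f'), f = f' →
      R.cls f hf = R.cls f' hf' := by
    rintro f _ hf hf' rfl
    rfl
  funext k
  by_cases hk : k = x
  · exact (if_pos hk).trans (hcongr _ _ _ _ (if_pos hk).symm)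
  · exact (if_neg hk).trans (hcongr _ _ _ _ (if_neg hk).symm)

theorem RUP.tval_cls (R : RUP S X U) (hR : RCA0 S X) (hw : ∀ k, w k ∈ X) {F : ℕ → S.M → S.M}
    (hF : ∀ k, FuncIn S X (F k)) (t : Term) :
    tval R.K (fun k => R.cls (F k) (hF k)) t =
      R.cls (fun i => tval S (fun k => F k i) t) (hR.funcIn_tval hw hF t) := by
  induction t with
  | var k => rfl
  | zero => exact R.zero_eq
  | one => exact R.one_eq
  | add t u ht hu =>
    simp only [tval, ht, hu]
    exact R.add_eq _ _ _ _ _ _ fun _ => rfl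
  | mul t u ht hu =>
    simp only [tval, ht, hu]
    exact R.mul_eq _ _ _ _ _ _ fun _ => rfl

/-- The equivalence asserted by Łoś's theorem for a formula and its truth set. -/
def RUP.Los (R : RUP S X U) (w : ℕ → Set S.M) (φ : Fml) : Prop :=
  ∀ (F : ℕ → S.M → S.M) (hF : ∀ k, FuncIn S X (F k)),
    Sat R.K R.X2 (fun k => R.cls (F k) (hF k)) (fun k => R.setImg (w k)) φ ↔
      {i | Sat S X (fun k => F k i) w φ} ∈ U

theorem RUP.Los.not (hR : RCA0 S X) (hU : UltraOn S X U) {R : RUP S X U} (hw : ∀ k, w k ∈ X)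
    {φ : Fml} (hφ : Delta0SO φ) (h : R.Los w φ) : R.Los w (.not φ) := fun F hF =>
  (not_congr (h F hF)).trans (hU.not_iff (hR.truthSet_mem hw hφ hF))

theorem RUP.Los.bex (hR : RCA0 S X) (hU : UltraOn S X U) {R : RUP S X U} (hw : ∀ k, w k ∈ X)
    {φ : Fml} (hφ : Delta0SO φ) (h : R.Los w φ) (x : ℕ) (t : Term) : R.Los w (.bex x t φ) := by
  intro F hF
  have hX := hR.truthSet_mem hw (Delta0SO.bex x t hφ) hF
  have ht := hR.funcIn_tval hw hF t
  constructor
  · rintro ⟨b, hb, hs⟩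
    obtain ⟨g, hg, rfl⟩ := R.surj b
    rw [R.tval_cls hR hw, R.lt_iff] at hb
    rw [R.upd_cls, h] at hs
    refine hU.superset_mem _ (hU.inter_mem _ hb _ hs) _ hX ?_
    rintro i ⟨h1, h2⟩
    rw [Set.mem_ofPred_eq, upd_apply] at h2
    exact ⟨g i, h1, h2⟩
  · intro hA
    have hB := hR.truthSet_mem hw hφ (hR.funcIn_extFun hw hF x)
    have hlt := hR.setOf_rel_mem hw (r := S.lt) (BddDef.lt (.var 3) (.var 4)) (hR.funcIn_snd hw)
      (hR.funcIn_comp ht (hR.funcIn_fst hw))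
    have hC := hR.inter_mem hlt hB
    obtain ⟨g, hg, hgA⟩ := hR.exists_funcIn_least hX hC (by
      rintro i ⟨y, hy, hs⟩
      refine ⟨y, ?_, ?_⟩
      · simpa only [Set.mem_ofPred_eq, hR.1.fst_pair, hR.1.snd_pair] using hy
      · simpa only [Set.mem_ofPred_eq, extFun_pair hR.1] using hs)
    refine ⟨R.cls g hg, ?_, ?_⟩
    · rw [R.tval_cls hR hw, R.lt_iff]
      refine hU.superset_mem _ hA _ (hR.setOf_rel_mem hw (r := S.lt)
        (BddDef.lt (.var 3) (.var 4)) hg ht) fun i hi => ?_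
      have := (hgA i hi).1
      simpa only [Set.mem_ofPred_eq, hR.1.fst_pair, hR.1.snd_pair] using this
    · rw [R.upd_cls, h]
      refine hU.superset_mem _ hA _ (hR.truthSet_mem hw hφ (funcIn_upd hF hg x)) fun i hi => ?_
      have := (hgA i hi).2
      rw [Set.mem_ofPred_eq, upd_apply]
      simpa only [Set.mem_ofPred_eq, extFun_pair hR.1] using this

theorem RUP.los_delta0 (R : RUP S X U) (hR : RCA0 S X) (hU : UltraOn S X U) (hw : ∀ k, w k ∈ X)
    {φ : Fml} (hφ : Delta0SO φ) : R.Los w φ := by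
  induction hφ with
  | eq t u =>
    intro F hF
    simp only [Sat, R.tval_cls hR hw, R.eq_iff]
  | lt t u =>
    intro F hF
    simp only [Sat, R.tval_cls hR hw, R.lt_iff]
  | mem t k =>
    intro F hF
    simp only [Sat, R.tval_cls hR hw]
    exact R.mem_iff _ _ _ (hw k)
  | not hφ ih => exact ih.not hR hU hw hφ
  | and hφ hψ ih ih' =>
    intro F hF
    exact (and_congr (ih F hF) (ih' F hF)).trans
      (hU.and_iff (hR.truthSet_mem hw hφ hF) (hR.truthSet_mem hw hψ hF)).symm
  | @or φ ψ hφ hψ ih ih' =>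
    intro F hF
    have key := hU.and_iff (hR.truthSet_mem hw hφ.not hF) (hR.truthSet_mem hw hψ.not hF)
    have h3 := hU.not_iff (hR.truthSet_mem hw (hφ.or hψ) hF)
    have h1 := ih.not hR hU hw hφ F hF
    have h2 := ih'.not hR hU hw hψ F hF
    simp only [Sat, not_or] at h1 h2 h3 key ⊢
    tauto
  | @imp φ ψ hφ hψ ih ih' =>
    intro F hF
    have key := hU.and_iff (hR.truthSet_mem hw hφ hF) (hR.truthSet_mem hw hψ.not hF)
    have h3 := hU.not_iff (hR.truthSet_mem hw (hφ.imp hψ) hF)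
    have h1 := ih F hF
    have h2 := ih'.not hR hU hw hψ F hF
    simp only [Sat, Classical.not_imp] at h1 h2 h3 key ⊢
    tauto
  | @ball x t φ hφ ih =>
    intro F hF
    have := ((ih.not hR hU hw hφ).bex hR hU hw hφ.not x t).not hR hU hw (hφ.not.bex x t) F hF
    simpa only [Sat, not_exists, not_and, not_not] using this
  | bex x t hφ ih => exact ih.bex hR hU hw hφ x t

theorem RUP.los_exBdd (R : RUP S X U) (hR : RCA0 S X) (hU : UltraOn S X U) (hw : ∀ k, w k ∈ X)
    {φ : Fml} (hφ : ExBdd φ) : ∀ (F : ℕ → S.M → S.M) (hF : ∀ k, FuncIn S X (F k)),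
      Sat R.K R.X2 (fun k => R.cls (F k) (hF k)) (fun k => R.setImg (w k)) φ ↔
        ∃ A ∈ U, A ⊆ {i | Sat S X (fun k => F k i) w φ} := by
  induction hφ with
  | delta0 h =>
    intro F hF
    rw [R.los_delta0 hR hU hw h F hF]
    exact ⟨fun hA => ⟨_, hA, subset_rfl⟩,
      fun ⟨A, hA, hs⟩ => hU.superset_mem _ hA _ (hR.truthSet_mem hw h hF) hs⟩
  | @ex x φ hφ ih =>
    intro F hF
    constructor
    · rintro ⟨b, hs⟩
      obtain ⟨g, hg, rfl⟩ := R.surj b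
      rw [R.upd_cls, ih] at hs
      obtain ⟨A, hA, hs⟩ := hs
      refine ⟨A, hA, fun i hi => ⟨g i, ?_⟩⟩
      rw [← upd_apply]
      exact hs hi
    · rintro ⟨A, hA, hs⟩
      obtain ⟨B, hB, hBs⟩ := hR.exBdd_projection hw hφ (hR.funcIn_extFun hw hF x)
      obtain ⟨C, hC, hCB⟩ := hR.mem_reindex hw hB
      obtain ⟨q, hq, hqA⟩ := hR.exists_funcIn_least (hU.subset hA) hC (by
        intro i hi
        obtain ⟨y, hy⟩ := hs hi
        rw [← extFun_pair hR.1, hBs] at hy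
        obtain ⟨z, hz⟩ := hy
        exact ⟨pairS S y z, by rwa [hCB, hR.1.fst_pair, hR.1.snd_pair]⟩)
      have hg := hR.funcIn_comp (hR.funcIn_fst hw) hq
      refine ⟨R.cls _ hg, ?_⟩
      rw [R.upd_cls, ih]
      refine ⟨A, hA, fun i hi => ?_⟩
      rw [Set.mem_ofPred_eq, upd_apply, ← extFun_pair hR.1, hBs]
      exact ⟨_, (hCB _ _).1 (hqA i hi)⟩

end Los

/-- Restricted Łoś theorem, Theorem `thm:los`.
Let `(M, 𝒳) ⊨ RCA₀`, `ℱ` the class of total functions `M → M` lying in `𝒳`,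
`𝒰` an ultrafilter on `𝒳` all of whose elements are cofinal in `M`, and
`(ℱ/𝒰, 𝒳)` the second-order restricted ultrapower.  Then:
(1) for every `Σ₁⁰` formula `φ(x̄)` with parameters from `(M, 𝒳)`,
`(ℱ/𝒰, 𝒳) ⊨ φ([f̄])` iff there is `A ∈ 𝒰` with
`A ⊆ {i ∈ M : (M, 𝒳) ⊨ φ(f̄(i))}`;
(2) for every formula `φ(x̄)` which is `Δ₁⁰` over `(M, 𝒳)` (i.e. `Σ₁⁰` and
equivalent in `(M, 𝒳)` to a `Π₁⁰` formula), `(ℱ/𝒰, 𝒳) ⊨ φ([f̄])` iff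
`{i ∈ M : (M, 𝒳) ⊨ φ(f̄(i))} ∈ 𝒰`. -/
theorem statement_1 (S : Str) (X U : Set (Set S.M))
    (hRCA : RCA0 S X) (hU : UltraOn S X U) (R : RUP S X U) :
    (∀ φ : Fml, SigmaSO 1 φ →
      ∀ (F : ℕ → S.M → S.M) (hF : ∀ k, FuncIn S X (F k))
        (w : ℕ → Set S.M), (∀ k, w k ∈ X) →
        (Sat R.K R.X2 (fun k => R.cls (F k) (hF k)) (fun k => R.setImg (w k)) φ ↔
          ∃ A ∈ U, A ⊆ {i : S.M | Sat S X (fun k => F k i) w φ})) ∧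
    (∀ φ ψ : Fml, SigmaSO 1 φ → PiSO 1 ψ →
      ∀ (F : ℕ → S.M → S.M) (hF : ∀ k, FuncIn S X (F k))
        (w : ℕ → Set S.M), (∀ k, w k ∈ X) →
        (∀ u : ℕ → S.M, Sat S X u w φ ↔ Sat S X u w ψ) →
        (Sat R.K R.X2 (fun k => R.cls (F k) (hF k)) (fun k => R.setImg (w k)) φ ↔
          {i : S.M | Sat S X (fun k => F k i) w φ} ∈ U)) := by
  refine ⟨fun φ hφ F hF w hw => R.los_exBdd hRCA hU hw hφ.exBdd F hF,
    fun φ ψ hφ hψ F hF w hw h => ?_⟩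
  rw [R.los_exBdd hRCA hU hw hφ.exBdd F hF]
  exact ⟨fun ⟨A, hA, hs⟩ => hU.superset_mem _ hA _
    (hRCA.delta1_truthSet_mem hw hφ hψ h hF) hs, fun hA => ⟨_, hA, subset_rfl⟩⟩

end PaperArith
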